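/- Let the standing assumptions hold and let δ, ε > 0. For every bounded set X₀ ⊆ dom Φ there exists ᾱ > 0 such that for every proximal-random-reshuffling sequence (x_k) initialized at some x₀ ∈ X₀ with step sizes satisfying α_k ∈ (0, ᾱ] for all k and Σ_{k=0}^∞ α_k = ∞, there exists an index k such that x_k is (ε,δ)-near approximate D_Φ-stationary, i.e. inf{‖v‖ : v ∈ D_Φ(y) for some y with ‖y − x_k‖ ≤ ε} ≤ δ. -/

import Mathlib

open scoped RealInnerProductSpace
open MeasureTheory

noncomputable section

/-- Euclidean space ℝ^d. -/
abbrev Euc (d : ℕ) := EuclideanSpace ℝ (Fin d)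

/-- Convex subdifferential of an extended-real-valued function. -/
def Subdiff {d : ℕ} (g : Euc d → EReal) (x : Euc d) : Set (Euc d) :=
  {v | ∀ y : Euc d, g x + ((⟪v, y - x⟫ : ℝ) : EReal) ≤ g y}

/-- Proper: somewhere finite and never −∞. -/
def ProperFn {d : ℕ} (g : Euc d → EReal) : Prop :=
  (∃ x, g x ≠ ⊤) ∧ ∀ x, g x ≠ ⊥

/-- Convexity via the epigraph. -/
def ConvexFn {d : ℕ} (g : Euc d → EReal) : Prop :=
  Convex ℝ {p : Euc d × ℝ | g p.1 ≤ (p.2 : EReal)}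

/-- Locally Lipschitz on the domain `{x | g x ≠ ⊤}`. -/
def LocLipOnDom {d : ℕ} (g : Euc d → EReal) : Prop :=
  ∀ x : Euc d, g x ≠ ⊤ → ∃ ε > (0:ℝ), ∃ K : ℝ, ∀ y : Euc d, g y ≠ ⊤ → ∀ z : Euc d, g z ≠ ⊤ →
    ‖y - x‖ ≤ ε → ‖z - x‖ ≤ ε → |(g y).toReal - (g z).toReal| ≤ K * ‖y - z‖

/-- A set-valued map is locally bounded. -/
def LocBounded {d : ℕ} (F : Euc d → Set (Euc d)) : Prop :=
  ∀ x : Euc d, ∃ ε > (0:ℝ), Bornology.IsBounded (⋃ y ∈ Metric.ball x ε, F y)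

/-- `D` is a conservative field for the locally Lipschitz function `f : ℝ^d → ℝ`. -/
def IsConservativeFieldR {d : ℕ} (D : Euc d → Set (Euc d)) (f : Euc d → ℝ) : Prop :=
  IsClosed {p : Euc d × Euc d | p.2 ∈ D p.1} ∧
  ∀ x u : ℝ → Euc d, IntervalIntegrable u volume 0 1 →
    (∀ t ∈ Set.Icc (0:ℝ) 1, x t = x 0 + ∫ s in (0:ℝ)..t, u s) →
    (∀ t ∈ Set.Icc (0:ℝ) 1, (D (x t)).Nonempty) →
    ∀ᵐ t ∂volume, t ∈ Set.Ioo (0:ℝ) 1 →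
      ∀ v ∈ D (x t), HasDerivAt (fun s => f (x s)) (⟪v, u t⟫ : ℝ) t

/-- The objective `Φ = f₁ + ⋯ + f_N + g`. -/
def Phi {d : ℕ} (N : ℕ) (f : Fin N → Euc d → ℝ) (g : Euc d → EReal) (x : Euc d) : EReal :=
  ((∑ i, f i x : ℝ) : EReal) + g x

/-- The field `D_Φ = D₁ + ⋯ + D_N + ∂g` (pointwise Minkowski sum). -/
def DPhi {d : ℕ} (N : ℕ) (D : Fin N → Euc d → Set (Euc d)) (g : Euc d → EReal)
    (x : Euc d) : Set (Euc d) :=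
  {w : Euc d | ∃ v : Fin N → Euc d, (∀ i, v i ∈ D i x) ∧
    ∃ s ∈ Subdiff g x, w = (∑ i, v i) + s}

/-- `(α, x)` is a proximal random reshuffling sequence: at each outer iteration `k`
there are a permutation `σ` and inner iterates `z` performing one subgradient step
for each `D_{σ(i)}` followed by a proximal step for `g`
(`x (k+1)` minimizes `w ↦ g w + ‖w − z_N‖²/(2 α_k)`). -/
def IsPRR {d : ℕ} (N : ℕ) (D : Fin N → Euc d → Set (Euc d)) (g : Euc d → EReal)
    (α : ℕ → ℝ) (x : ℕ → Euc d) : Prop :=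
  ∀ k : ℕ, ∃ (σ : Equiv.Perm (Fin N)) (z : ℕ → Euc d),
    z 0 = x k ∧
    (∀ i : Fin N, ∃ v ∈ D (σ i) (z i.1), z (i.1 + 1) = z i.1 - α k • v) ∧
    (∀ w : Euc d,
      g (x (k+1)) + ((‖x (k+1) - z N‖ ^ 2 / (2 * α k) : ℝ) : EReal) ≤
        g w + ((‖w - z N‖ ^ 2 / (2 * α k) : ℝ) : EReal))

/-- Standing assumptions of the paper: each `f_i` is locally Lipschitz, each `D_i`
is a locally bounded conservative field for `f_i` with nonempty convex values,
`g` is proper, convex, with closed domain and locally Lipschitz on its domain,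
and `Φ = f₁ + ⋯ + f_N + g` is bounded below. -/
def StandingAssumptions {d : ℕ} (N : ℕ) (f : Fin N → Euc d → ℝ)
    (D : Fin N → Euc d → Set (Euc d)) (g : Euc d → EReal) : Prop :=
  (∀ i, LocallyLipschitz (f i)) ∧
  (∀ i, IsConservativeFieldR (D i) (f i)) ∧
  (∀ i, LocBounded (D i)) ∧
  (∀ i x, (D i x).Nonempty ∧ Convex ℝ (D i x)) ∧
  ProperFn g ∧ ConvexFn g ∧ IsClosed {x : Euc d | g x ≠ ⊤} ∧ LocLipOnDom g ∧
  ∃ c : ℝ, ∀ x : Euc d, (c : EReal) ≤ Phi N f g x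


/-- A Lipschitz curve in a finite-dimensional space is the integral of its derivative. -/
theorem LipschitzWith.integral_deriv_eq_sub {V : Type*} [NormedAddCommGroup V] [NormedSpace ℝ V]
    [FiniteDimensional ℝ V] {C : NNReal} {y : ℝ → V} (hy : LipschitzWith C y) (a b : ℝ) :
    IntervalIntegrable (deriv y) volume a b ∧ ∫ s in a..b, deriv y s = y b - y a := by
  have : CompleteSpace V := FiniteDimensional.complete ℝ V
  have hloc (a b : ℝ) : IntervalIntegrable (deriv y) volume a b := by
    refine (intervalIntegrable_const (c := (C : ℝ))).mono_fun
      (stronglyMeasurable_deriv y).aestronglyMeasurable (Filter.Eventually.of_forall fun t => ?_)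
    simpa using norm_deriv_le_of_lipschitz hy
  refine ⟨hloc a b, ?_⟩
  have hI : LipschitzWith C fun t => ∫ s in a..t, deriv y s := by
    refine LipschitzWith.of_dist_le_mul fun t t' => ?_
    rw [dist_eq_norm, intervalIntegral.integral_interval_sub_left (hloc a t) (hloc a t'),
      Real.dist_eq]
    exact intervalIntegral.norm_integral_le_of_norm_le_const
      fun _ _ => norm_deriv_le_of_lipschitz hy
  have hyac := (hy.lipschitzOnWith (s := Set.uIcc a b)).absolutelyContinuousOnInterval
  have hIac := (hI.lipschitzOnWith (s := Set.uIcc a b)).absolutelyContinuousOnInterval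
  obtain ⟨c, hc⟩ := (hyac.sub hIac).const_of_ae_hasDerivAt_zero (by
    filter_upwards [hy.ae_differentiableAt_real, (hloc a b).ae_hasDerivAt_integral] with t h1 h2 ht
    simpa using h1.hasDerivAt.sub (h2 ht a (by simp)))
  have ha := hc a (by simp)
  have hb := hc b (by simp)
  simp only [Pi.sub_apply, intervalIntegral.integral_same, sub_zero] at ha hb
  rw [ha, ← hb]; abel

theorem AbsolutelyContinuousOnInterval.apply_one_le_apply_zero {φ : ℝ → ℝ}
    (hφ : AbsolutelyContinuousOnInterval φ 0 1)
    (hd : ∀ᵐ t, t ∈ Set.Ioo (0 : ℝ) 1 → ∃ a ≤ 0, HasDerivAt φ a t) : φ 1 ≤ φ 0 := by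
  have h := hφ.integral_deriv_eq_sub
  have h2 : ∫ t in (0 : ℝ)..1, deriv φ t ≤ 0 := by
    rw [intervalIntegral.integral_of_le zero_le_one, integral_Ioc_eq_integral_Ioo]
    refine setIntegral_nonpos_of_ae_restrict ?_
    rw [Filter.EventuallyLE, ae_restrict_iff' measurableSet_Ioo]
    filter_upwards [hd] with t ht hmem
    obtain ⟨a, ha, hφ'⟩ := ht hmem
    simpa [hφ'.deriv] using ha
  linarith

/-- Outer semicontinuity of a locally bounded set-valued map with closed graph. -/
theorem eventually_subset_thickening {V : Type*} [NormedAddCommGroup V] [ProperSpace V]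
    {F : V → Set V} (hF : IsClosed {p : V × V | p.2 ∈ F p.1}) {x : V} {r : ℝ} (hr : 0 < r)
    (hb : Bornology.IsBounded (⋃ y ∈ Metric.ball x r, F y)) {η : ℝ} (hη : 0 < η) :
    ∀ᶠ y in nhds x, F y ⊆ Metric.thickening η (F x) := by
  obtain ⟨C, hC⟩ := hb.subset_closedBall 0
  have hB : IsCompact (Metric.closedBall (0 : V) C \ Metric.thickening η (F x)) :=
    (isCompact_closedBall 0 C).diff Metric.isOpen_thickening
  obtain ⟨u, v, hu, -, hxu, hv, huv⟩ := generalized_tube_lemma (isCompact_singleton (x := x)) hB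
    hF.isOpen_compl (by
      rintro ⟨a, b⟩ ⟨rfl, hb, hb'⟩ hab
      exact hb' (Metric.self_subset_thickening hη _ hab))
  filter_upwards [hu.mem_nhds (hxu rfl), Metric.ball_mem_nhds x hr] with y hy hyr b hb
  by_contra hbt
  exact huv (Set.mk_mem_prod hy (hv ⟨hC (Set.mem_biUnion hyr hb), hbt⟩)) hb

section ProperConvex

variable {d : ℕ} {g : Euc d → EReal}

theorem ProperFn.coe_toReal (hg : ProperFn g) {x : Euc d} (hx : g x ≠ ⊤) :
    ((g x).toReal : EReal) = g x :=
  EReal.coe_toReal hx (hg.2 x)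

theorem ProperFn.mem_subdiff_iff (hg : ProperFn g) {x v : Euc d} :
    v ∈ Subdiff g x ↔ g x ≠ ⊤ ∧
      ∀ y, g y ≠ ⊤ → (g x).toReal + ⟪v, y - x⟫ ≤ (g y).toReal := by
  constructor
  · intro h
    have hx : g x ≠ ⊤ := by
      obtain ⟨y, hy⟩ := hg.1
      intro hx
      have := h y
      rw [hx, EReal.top_add_coe, top_le_iff] at this
      exact hy this
    refine ⟨hx, fun y hy => ?_⟩
    have := h y
    rw [← hg.coe_toReal hx, ← hg.coe_toReal hy] at this
    exact_mod_cast this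
  · rintro ⟨hx, h⟩ y
    by_cases hy : g y = ⊤
    · simp [hy]
    · rw [← hg.coe_toReal hx, ← hg.coe_toReal hy]
      exact_mod_cast h y hy

theorem ConvexFn.convexOn_toReal (hc : ConvexFn g) (hg : ProperFn g) :
    ConvexOn ℝ {x | g x ≠ ⊤} fun x => (g x).toReal := by
  have key : ∀ ⦃x⦄, g x ≠ ⊤ → ∀ ⦃y⦄, g y ≠ ⊤ → ∀ ⦃a b : ℝ⦄, 0 ≤ a → 0 ≤ b → a + b = 1 →
      g (a • x + b • y) ≤ ((a • (g x).toReal + b • (g y).toReal : ℝ) : EReal) := by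
    intro x hx y hy a b ha hb hab
    have h1 : (x, (g x).toReal) ∈ {p : Euc d × ℝ | g p.1 ≤ (p.2 : EReal)} :=
      (hg.coe_toReal hx).ge
    have h2 : (y, (g y).toReal) ∈ {p : Euc d × ℝ | g p.1 ≤ (p.2 : EReal)} :=
      (hg.coe_toReal hy).ge
    exact hc h1 h2 ha hb hab
  have hdom : ∀ ⦃x⦄, g x ≠ ⊤ → ∀ ⦃y⦄, g y ≠ ⊤ → ∀ ⦃a b : ℝ⦄, 0 ≤ a → 0 ≤ b → a + b = 1 →
      g (a • x + b • y) ≠ ⊤ := fun x hx y hy a b ha hb hab h => by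
    have := key hx hy ha hb hab
    rw [h, top_le_iff] at this
    exact EReal.coe_ne_top _ this
  refine ⟨hdom, fun x hx y hy a b ha hb hab => ?_⟩
  have := key hx hy ha hb hab
  rw [← hg.coe_toReal (hdom hx hy ha hb hab)] at this
  exact_mod_cast this

/-- On bounded parts of its domain, a convex function that is locally Lipschitz there
decreases at most linearly, at a uniform rate, towards every point of the domain. -/
theorem LocLipOnDom.exists_forall_sub_le (hl : LocLipOnDom g)
    (hc : ConvexOn ℝ {x | g x ≠ ⊤} fun x => (g x).toReal) {K : Set (Euc d)} (hK : IsCompact K)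
    (hKg : ∀ x ∈ K, g x ≠ ⊤) :
    ∃ L ≥ (0 : ℝ), ∀ q ∈ K, ∀ p, g p ≠ ⊤ → (g q).toReal - (g p).toReal ≤ L * ‖p - q‖ := by
  refine hK.induction_on
    (p := fun t => ∃ L ≥ (0 : ℝ), ∀ q ∈ t, g q ≠ ⊤ →
      ∀ p, g p ≠ ⊤ → (g q).toReal - (g p).toReal ≤ L * ‖p - q‖) ⟨0, le_rfl, by simp⟩
    (fun s t hst ⟨L, hL, h⟩ => ⟨L, hL, fun q hq => h q (hst hq)⟩) ?_ ?_ |>.imp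
    fun L hL => ⟨hL.1, fun q hq => hL.2 q hq (hKg q hq)⟩
  · rintro s t ⟨L, hL, h⟩ ⟨L', hL', h'⟩
    refine ⟨max L L', hL.trans (le_max_left _ _), ?_⟩
    rintro q (hq | hq) hqg p hp
    · exact (h q hq hqg p hp).trans (by gcongr; exact le_max_left _ _)
    · exact (h' q hq hqg p hp).trans (by gcongr; exact le_max_right _ _)
  · intro x hx
    obtain ⟨r, hr, C, hC⟩ := hl x (hKg x hx)
    refine ⟨Metric.ball x (r / 2),
      mem_nhdsWithin_of_mem_nhds (Metric.ball_mem_nhds x (by positivity)), |C|, abs_nonneg _, ?_⟩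
    intro q hq hqg p hp
    rw [mem_ball_iff_norm] at hq
    obtain ⟨θ, hθ0, hθ1, hθ⟩ : ∃ θ : ℝ, 0 < θ ∧ θ ≤ 1 ∧ θ * ‖p - q‖ ≤ r / 2 := by
      have h : 0 < r / 2 / (‖p - q‖ + r / 2) := by positivity
      refine ⟨_, h, ?_, ?_⟩
      · rw [div_le_one (by positivity)]; linarith [norm_nonneg (p - q)]
      · rw [div_mul_eq_mul_div, div_le_iff₀ (by positivity)]
        nlinarith [norm_nonneg (p - q)]
    have hw : g ((1 - θ) • q + θ • p) ≠ ⊤ :=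
      hc.1 hqg hp (by linarith) hθ0.le (by ring)
    have hwq : (1 - θ) • q + θ • p - q = θ • (p - q) := by module
    have hwn : ‖(1 - θ) • q + θ • p - q‖ = θ * ‖p - q‖ := by
      rw [hwq, norm_smul, Real.norm_of_nonneg hθ0.le]
    have h1 := hc.2 hqg hp (by linarith : 0 ≤ 1 - θ) hθ0.le (by ring)
    have h2 := hC q hqg _ hw (by linarith) (by
      calc _ = ‖((1 - θ) • q + θ • p - q) + (q - x)‖ := by congr 1; abel
        _ ≤ _ := norm_add_le _ _
        _ ≤ r := by rw [hwn]; linarith)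
    rw [norm_sub_rev q, hwn] at h2
    have h3 := (le_abs_self _).trans h2
    have h4 : C * (θ * ‖p - q‖) ≤ |C| * (θ * ‖p - q‖) := by gcongr; exact le_abs_self _
    simp only [smul_eq_mul] at h1
    refine le_of_mul_le_mul_left ?_ hθ0
    nlinarith

theorem LocLipOnDom.continuousOn (hl : LocLipOnDom g) :
    ContinuousOn (fun x => (g x).toReal) {x | g x ≠ ⊤} := by
  intro x hx
  obtain ⟨r, hr, C, hC⟩ := hl x hx
  refine ContinuousWithinAt.congr_of_eventuallyEq_of_mem (f := fun x => (g x).toReal) ?_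
    Filter.EventuallyEq.rfl hx
  rw [ContinuousWithinAt, tendsto_iff_dist_tendsto_zero]
  refine squeeze_zero' (g := fun y => C * ‖y - x‖) (Filter.Eventually.of_forall fun _ =>
    dist_nonneg) ?_ ?_
  · filter_upwards [self_mem_nhdsWithin,
      mem_nhdsWithin_of_mem_nhds (Metric.closedBall_mem_nhds x hr)] with y hy hyr
    rw [Real.dist_eq]
    exact hC y hy x hx (mem_closedBall_iff_norm.1 hyr) (by simpa using hr.le)
  · refine Filter.Tendsto.mono_left ?_ nhdsWithin_le_nhds
    have : Continuous fun y : Euc d => C * ‖y - x‖ := by fun_prop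
    simpa using this.tendsto x

theorem ProperFn.isClosed_graph_subdiff (hg : ProperFn g) (hcl : IsClosed {x | g x ≠ ⊤})
    (hl : LocLipOnDom g) : IsClosed {p : Euc d × Euc d | p.2 ∈ Subdiff g p.1} := by
  have hS : IsClosed {p : Euc d × Euc d | g p.1 ≠ ⊤} := hcl.preimage continuous_fst
  have : {p : Euc d × Euc d | p.2 ∈ Subdiff g p.1} = {p | g p.1 ≠ ⊤} ∩
      ⋂ y ∈ {y | g y ≠ ⊤}, {p ∈ {p : Euc d × Euc d | g p.1 ≠ ⊤} |
        (g p.1).toReal + ⟪p.2, y - p.1⟫ ≤ (g y).toReal} := by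
    ext p
    simp only [Set.mem_ofPred_eq, hg.mem_subdiff_iff, Set.mem_inter_iff, Set.mem_iInter]
    grind
  rw [this]
  refine hS.inter (isClosed_biInter fun y _ => hS.isClosed_le ?_ continuousOn_const)
  exact (hl.continuousOn.comp continuousOn_fst fun _ hp => hp).add
    (Continuous.continuousOn (by fun_prop))

theorem convex_subdiff (hg : ProperFn g) (x : Euc d) : Convex ℝ (Subdiff g x) := by
  intro u hu v hv a b ha hb hab
  rw [hg.mem_subdiff_iff] at hu hv ⊢
  refine ⟨hu.1, fun y hy => ?_⟩
  have h1 := hu.2 y hy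
  have h2 := hv.2 y hy
  rw [inner_add_left, real_inner_smul_left, real_inner_smul_left]
  have : a = 1 - b := by linarith
  subst this
  nlinarith

/-- First-order optimality of a proximal point. -/
theorem smul_sub_mem_subdiff_of_prox (hg : ProperFn g)
    (hc : ConvexOn ℝ {x | g x ≠ ⊤} fun x => (g x).toReal) {α : ℝ} (hα : 0 < α) {p z : Euc d}
    (hp : ∀ w, g p + ((‖p - z‖ ^ 2 / (2 * α) : ℝ) : EReal) ≤
      g w + ((‖w - z‖ ^ 2 / (2 * α) : ℝ) : EReal)) :
    α⁻¹ • (z - p) ∈ Subdiff g p := by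
  have hpg : g p ≠ ⊤ := by
    obtain ⟨y, hy⟩ := hg.1
    intro hpt
    have := hp y
    rw [hpt, EReal.top_add_coe, top_le_iff, ← hg.coe_toReal hy, ← EReal.coe_add] at this
    exact EReal.coe_ne_top _ this
  refine hg.mem_subdiff_iff.2 ⟨hpg, fun y hy => ?_⟩
  have key : ∀ θ ∈ Set.Ioc (0 : ℝ) 1, (g p).toReal + ⟪α⁻¹ • (z - p), y - p⟫ ≤
      (g y).toReal + θ * (‖y - p‖ ^ 2 / (2 * α)) := by
    rintro θ ⟨hθ, hθ1⟩
    have hw : g ((1 - θ) • p + θ • y) ≠ ⊤ := hc.1 hpg hy (by linarith) hθ.le (by ring)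
    have h1 := hc.2 hpg hy (by linarith : 0 ≤ 1 - θ) hθ.le (by ring)
    have h2 := hp ((1 - θ) • p + θ • y)
    rw [← hg.coe_toReal hpg, ← hg.coe_toReal hw] at h2
    have h3 : (g p).toReal + ‖p - z‖ ^ 2 / (2 * α) ≤
      (g ((1 - θ) • p + θ • y)).toReal + ‖(1 - θ) • p + θ • y - z‖ ^ 2 / (2 * α) := by
      exact_mod_cast h2
    have h4 : (1 - θ) • p + θ • y - z = θ • (y - p) - (z - p) := by module
    rw [h4, norm_sub_rev p z, norm_sub_sq_real (θ • (y - p)), norm_smul, real_inner_smul_left,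
      Real.norm_of_nonneg hθ.le, real_inner_comm] at h3
    rw [real_inner_smul_left]
    simp only [smul_eq_mul] at h1
    refine le_of_mul_le_mul_left ?_ hθ
    have h5 : ((θ * ‖y - p‖) ^ 2 - 2 * (θ * ⟪z - p, y - p⟫) + ‖z - p‖ ^ 2) / (2 * α) =
      θ * (θ * (‖y - p‖ ^ 2 / (2 * α))) - θ * (α⁻¹ * ⟪z - p, y - p⟫) + ‖z - p‖ ^ 2 / (2 * α) := by
      field_simp
    rw [h5] at h3
    nlinarith
  have hlim : Filter.Tendsto (fun θ : ℝ => (g y).toReal + θ * (‖y - p‖ ^ 2 / (2 * α)))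
      (nhdsWithin 0 (Set.Ioi 0)) (nhds ((g y).toReal)) := by
    refine Filter.Tendsto.mono_left ?_ nhdsWithin_le_nhds
    have : Continuous fun θ : ℝ => (g y).toReal + θ * (‖y - p‖ ^ 2 / (2 * α)) := by fun_prop
    simpa using this.tendsto 0
  refine ge_of_tendsto hlim ?_
  filter_upwards [Ioc_mem_nhdsGT (zero_lt_one' ℝ)] with θ hθ using key θ hθ

end ProperConvex

section Step

variable {d N : ℕ}

theorem LocBounded.exists_forall_norm_le {F : Euc d → Set (Euc d)} (hF : LocBounded F)
    {K : Set (Euc d)} (hK : IsCompact K) : ∃ C ≥ (0 : ℝ), ∀ x ∈ K, ∀ v ∈ F x, ‖v‖ ≤ C := by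
  refine hK.induction_on (p := fun t => ∃ C ≥ (0 : ℝ), ∀ x ∈ t, ∀ v ∈ F x, ‖v‖ ≤ C)
    ⟨0, le_rfl, by simp⟩ (fun s t hst ⟨C, hC, h⟩ => ⟨C, hC, fun x hx => h x (hst hx)⟩) ?_ ?_
  · rintro s t ⟨C, hC, h⟩ ⟨C', hC', h'⟩
    refine ⟨max C C', hC.trans (le_max_left _ _), ?_⟩
    rintro x (hx | hx) v hv
    · exact (h x hx v hv).trans (le_max_left _ _)
    · exact (h' x hx v hv).trans (le_max_right _ _)
  · intro x _
    obtain ⟨r, hr, hb⟩ := hF x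
    obtain ⟨C, hC⟩ := hb.subset_closedBall 0
    refine ⟨Metric.ball x r, mem_nhdsWithin_of_mem_nhds (Metric.ball_mem_nhds x hr),
      |C|, abs_nonneg _, fun y hy v hv => ?_⟩
    exact (mem_closedBall_zero_iff.1 (hC (Set.mem_biUnion hy hv))).trans (le_abs_self C)

theorem exists_forall_norm_le_of_locBounded {D : Fin N → Euc d → Set (Euc d)}
    (hD : ∀ i, LocBounded (D i)) {K : Set (Euc d)} (hK : IsCompact K) :
    ∃ C ≥ (0 : ℝ), ∀ i, ∀ x ∈ K, ∀ v ∈ D i x, ‖v‖ ≤ C := by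
  choose C hC h using fun i => (hD i).exists_forall_norm_le hK
  refine ⟨∑ i, C i, Finset.sum_nonneg fun i _ => hC i, fun i x hx v hv => ?_⟩
  exact (h i x hx v hv).trans (Finset.single_le_sum (fun i _ => hC i) (Finset.mem_univ i))

/-- The elements of `D_Φ x` whose component in `∂g x` has norm at most `A`. -/
def boundedDPhi (D : Fin N → Euc d → Set (Euc d)) (g : Euc d → EReal) (A : ℝ) (x : Euc d) :
    Set (Euc d) :=
  {w | ∃ v : Fin N → Euc d, (∀ i, v i ∈ D i x) ∧
    ∃ s ∈ Subdiff g x, ‖s‖ ≤ A ∧ w = (∑ i, v i) + s}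

theorem boundedDPhi_subset (D : Fin N → Euc d → Set (Euc d)) (g : Euc d → EReal) (A : ℝ)
    (x : Euc d) : boundedDPhi D g A x ⊆ DPhi N D g x :=
  fun _ ⟨v, hv, s, hs, _, hw⟩ => ⟨v, hv, s, hs, hw⟩

theorem convex_boundedDPhi {D : Fin N → Euc d → Set (Euc d)} {g : Euc d → EReal}
    (hg : ProperFn g) {x : Euc d} (hD : ∀ i, Convex ℝ (D i x)) (A : ℝ) :
    Convex ℝ (boundedDPhi D g A x) := by
  rintro _ ⟨v, hv, s, hs, hsA, rfl⟩ _ ⟨v', hv', s', hs', hsA', rfl⟩ a b ha hb hab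
  refine ⟨fun i => a • v i + b • v' i, fun i => hD i (hv i) (hv' i) ha hb hab,
    a • s + b • s', convex_subdiff hg x hs hs' ha hb hab, ?_, ?_⟩
  · rw [← mem_closedBall_zero_iff] at *
    exact convex_closedBall 0 A hsA hsA' ha hb hab
  · rw [Finset.sum_add_distrib, ← Finset.smul_sum, ← Finset.smul_sum]; module

theorem isClosed_apply_of_isClosed_graph {V W : Type*} [TopologicalSpace V] [TopologicalSpace W]
    {F : V → Set W} (hF : IsClosed {p : V × W | p.2 ∈ F p.1}) (x : V) : IsClosed (F x) :=
  hF.preimage (Continuous.prodMk_right x)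

theorem isCompact_boundedDPhi {D : Fin N → Euc d → Set (Euc d)} {g : Euc d → EReal}
    (hD : ∀ i, IsClosed {p : Euc d × Euc d | p.2 ∈ D i p.1}) (hDb : ∀ i, LocBounded (D i))
    (hg : IsClosed {p : Euc d × Euc d | p.2 ∈ Subdiff g p.1}) (A : ℝ) (x : Euc d) :
    IsCompact (boundedDPhi D g A x) := by
  have h1 : IsCompact (Set.univ.pi fun i => D i x) := by
    refine isCompact_univ_pi fun i => ?_
    obtain ⟨C, -, hC⟩ := (hDb i).exists_forall_norm_le (isCompact_singleton (x := x))
    exact (isCompact_closedBall 0 C).of_isClosed_subset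
      (isClosed_apply_of_isClosed_graph (hD i) x)
      fun v hv => mem_closedBall_zero_iff.2 (hC x rfl v hv)
  have h2 : IsCompact (Subdiff g x ∩ Metric.closedBall 0 A) :=
    (isCompact_closedBall 0 A).inter_left (isClosed_apply_of_isClosed_graph hg x)
  convert (h1.prod h2).image
    (f := fun p : (Fin N → Euc d) × Euc d => (∑ i, p.1 i) + p.2) (by fun_prop) using 1
  ext w
  constructor
  · rintro ⟨v, hv, s, hs, hsA, rfl⟩
    exact ⟨(v, s), ⟨fun i _ => hv i, hs, mem_closedBall_zero_iff.2 hsA⟩, rfl⟩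
  · rintro ⟨⟨v, s⟩, ⟨hv, hs, hsA⟩, rfl⟩
    exact ⟨v, fun i => hv i trivial, s, hs, mem_closedBall_zero_iff.1 hsA, rfl⟩

/-- Sums of elements of `D i` and `∂g` taken near `x` are close to `boundedDPhi D g A x`. -/
theorem exists_forall_mem_cthickening_boundedDPhi {D : Fin N → Euc d → Set (Euc d)}
    {g : Euc d → EReal} (hD : ∀ i, IsClosed {p : Euc d × Euc d | p.2 ∈ D i p.1})
    (hDb : ∀ i, LocBounded (D i))
    (hg : IsClosed {p : Euc d × Euc d | p.2 ∈ Subdiff g p.1}) (A : ℝ) (x : Euc d)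
    {η : ℝ} (hη : 0 < η) :
    ∃ ρ > 0, ∀ (ζ v : Fin N → Euc d) (p s : Euc d), (∀ i, ‖ζ i - x‖ < ρ) → ‖p - x‖ < ρ →
      (∀ i, v i ∈ D i (ζ i)) → s ∈ Subdiff g p → ‖s‖ ≤ A →
      (∑ i, v i) + s ∈ Metric.cthickening η (boundedDPhi D g A x) := by
  have hη' : 0 < η / (N + 1) := by positivity
  have h1 : ∀ᶠ y in nhds x, ∀ i, D i y ⊆ Metric.thickening (η / (N + 1)) (D i x) := by
    refine Filter.eventually_all.2 fun i => ?_
    obtain ⟨r, hr, hb⟩ := hDb i x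
    exact eventually_subset_thickening (hD i) hr hb hη'
  have h2 : ∀ᶠ y in nhds x, Subdiff g y ∩ Metric.closedBall 0 A ⊆
      Metric.thickening (η / (N + 1)) (Subdiff g x ∩ Metric.closedBall 0 A) := by
    refine eventually_subset_thickening (F := fun y => Subdiff g y ∩ Metric.closedBall 0 A)
      (hg.inter (Metric.isClosed_closedBall.preimage continuous_snd)) one_pos ?_ hη'
    refine (Metric.isBounded_closedBall (x := (0 : Euc d)) (r := A)).subset ?_
    exact Set.iUnion₂_subset fun _ _ => Set.inter_subset_right
  obtain ⟨ρ, hρ, h⟩ := Metric.eventually_nhds_iff.1 (h1.and h2)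
  refine ⟨ρ, hρ, fun ζ v p s hζ hp hv hs hsA => ?_⟩
  have hv' : ∀ i, ∃ v' ∈ D i x, dist (v i) v' < η / (N + 1) := fun i =>
    Metric.mem_thickening_iff.1 ((h (by simpa [dist_eq_norm] using hζ i)).1 i (hv i))
  choose v' hv'D hv' using hv'
  obtain ⟨s', hs', hss'⟩ := Metric.mem_thickening_iff.1
    ((h (by simpa [dist_eq_norm] using hp)).2 ⟨hs, mem_closedBall_zero_iff.2 hsA⟩)
  refine Metric.mem_cthickening_of_dist_le _ ((∑ i, v' i) + s') _ _
    ⟨v', hv'D, s', hs'.1, mem_closedBall_zero_iff.1 hs'.2, rfl⟩ ?_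
  calc dist ((∑ i, v i) + s) ((∑ i, v' i) + s')
      ≤ dist (∑ i, v i) (∑ i, v' i) + dist s s' := dist_add_add_le _ _ _ _
    _ ≤ (∑ i, dist (v i) (v' i)) + dist s s' := by
      gcongr; exact dist_sum_sum_le _ _ _
    _ ≤ (∑ _i : Fin N, η / (N + 1)) + η / (N + 1) := by
      gcongr with i
      exact (hv' i).le
    _ = η := by
      rw [Finset.sum_const, Finset.card_univ, Fintype.card_fin, nsmul_eq_mul]
      field_simp

/-- One outer iteration from `q` to `p` with step size `α` is a step along a bounded sum of
elements of `D i` and `∂g` evaluated near `q`. -/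
def IsBoundedStep (D : Fin N → Euc d → Set (Euc d)) (g : Euc d → EReal) (A α : ℝ)
    (q p w : Euc d) : Prop :=
  p = q - α • w ∧ ‖w‖ ≤ A ∧ ∃ (v ζ : Fin N → Euc d) (s : Euc d),
    (∀ i, v i ∈ D i (ζ i) ∧ ‖ζ i - q‖ ≤ A * α) ∧ s ∈ Subdiff g p ∧ ‖s‖ ≤ A ∧
      w = (∑ i, v i) + s

theorem exists_isBoundedStep {D : Fin N → Euc d → Set (Euc d)} {g : Euc d → EReal}
    (hDb : ∀ i, LocBounded (D i)) (hg : ProperFn g)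
    (hc : ConvexOn ℝ {x | g x ≠ ⊤} fun x => (g x).toReal) (hcl : IsClosed {x | g x ≠ ⊤})
    (hl : LocLipOnDom g) (R : ℝ) :
    ∃ A ≥ 0, ∃ α₀ > 0, ∀ (α : ℕ → ℝ) (x : ℕ → Euc d), IsPRR N D g α x →
      ∀ k, 0 < α k → α k ≤ α₀ → ‖x k‖ ≤ R → g (x k) ≠ ⊤ →
        ∃ w, IsBoundedStep D g A (α k) (x k) (x (k + 1)) w := by
  obtain ⟨C, hC0, hC⟩ := exists_forall_norm_le_of_locBounded hDb
    (isCompact_closedBall (0 : Euc d) (R + 1))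
  obtain ⟨L, hL0, hL⟩ := hl.exists_forall_sub_le hc
    ((isCompact_closedBall (0 : Euc d) R).inter_left hcl) fun x hx => hx.1
  refine ⟨L + 3 * (N * C), by positivity, 1 / (N * C + 1), by positivity, ?_⟩
  intro α x hx k hα0 hα hxR hxg
  obtain ⟨σ, z, hz0, hz, hprox⟩ := hx k
  have hNC : α k * (N * C) ≤ 1 := by
    rw [le_div_iff₀ (by positivity)] at hα; linarith
  have hbd : ∀ m ≤ N, ‖z m - x k‖ ≤ α k * (m * C) := by
    intro m
    induction m with
    | zero => simp [hz0]
    | succ m ih =>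
      intro hm
      have ih := ih (by omega)
      obtain ⟨v, hv, hzv⟩ := hz ⟨m, hm⟩
      have hmN : (m : ℝ) ≤ N := by exact_mod_cast (by omega : m ≤ N)
      have hzm : ‖z m‖ ≤ R + 1 := by
        have h1 : α k * (m * C) ≤ α k * (N * C) := by gcongr
        have h2 := norm_le_norm_add_norm_sub' (z m) (x k)
        linarith
      have hvC := hC _ _ (mem_closedBall_zero_iff.2 hzm) v hv
      simp only at hzv
      have h3 : z (m + 1) - x k = (z m - x k) - α k • v := by rw [hzv]; abel
      rw [h3]
      calc _ ≤ ‖z m - x k‖ + ‖α k • v‖ := norm_sub_le _ _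
        _ ≤ α k * (m * C) + α k * C := by
          rw [norm_smul, Real.norm_of_nonneg hα0.le]; gcongr
        _ = _ := by push_cast; ring
  have hzbd : ∀ m ≤ N, ‖z m - x k‖ ≤ α k * (N * C) := fun m hm =>
    (hbd m hm).trans (by gcongr)
  have hzR : ∀ m ≤ N, z m ∈ Metric.closedBall (0 : Euc d) (R + 1) := fun m hm => by
    rw [mem_closedBall_zero_iff]
    linarith [hzbd m hm, norm_le_norm_add_norm_sub' (z m) (x k)]
  choose v hv hzv using hz
  have hzN : z N = x k - α k • ∑ i, v i := by
    have h1 : ∀ i : Fin N, α k • v i = z i - z (i + 1) := fun i => by rw [hzv i]; abel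
    rw [Finset.smul_sum, Finset.sum_congr rfl fun i _ => h1 i,
      Fin.sum_univ_eq_sum_range (fun i => z i - z (i + 1)), Finset.sum_range_sub', hz0]
    abel
  set p := x (k + 1) with hp
  have hsub := smul_sub_mem_subdiff_of_prox hg hc hα0 hprox
  set s := (α k)⁻¹ • (z N - p) with hs
  have hps : p = z N - α k • s := by
    rw [hs, smul_inv_smul₀ hα0.ne']; abel
  have hpg := (hg.mem_subdiff_iff.1 hsub).1
  have hmove : ‖p - x k‖ ≤ α k * L + α k * (N * C) := by
    have h1 := (hg.mem_subdiff_iff.1 hsub).2 (x k) hxg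
    have h2 := hL (x k) ⟨hxg, mem_closedBall_zero_iff.2 hxR⟩ p hpg
    have h3 : ⟪s, x k - p⟫ = (α k)⁻¹ * (⟪z N - x k, x k - p⟫ + ‖p - x k‖ ^ 2) := by
      rw [hs, real_inner_smul_left, norm_sub_rev, ← real_inner_self_eq_norm_sq,
        ← inner_add_left, sub_add_sub_cancel]
    have h4 : -(‖z N - x k‖ * ‖p - x k‖) ≤ ⟪z N - x k, x k - p⟫ := by
      rw [norm_sub_rev p]
      exact (abs_le.1 (abs_real_inner_le_norm _ _)).1
    have h5 := hzbd N le_rfl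
    have h6 : (α k)⁻¹ * (⟪z N - x k, x k - p⟫ + ‖p - x k‖ ^ 2) ≤ L * ‖p - x k‖ := by linarith
    rw [inv_mul_le_iff₀ hα0] at h6
    rcases (norm_nonneg (p - x k)).eq_or_lt with h0 | h0
    · rw [← h0]; positivity
    · refine le_of_mul_le_mul_right ?_ h0
      nlinarith
  have hsum : ‖∑ i, v i‖ ≤ N * C := by
    calc ‖∑ i, v i‖ ≤ ∑ i, ‖v i‖ := norm_sum_le _ _
      _ ≤ ∑ _i : Fin N, C := Finset.sum_le_sum fun i _ => hC _ _ (hzR i i.2.le) _ (hv i)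
      _ = N * C := by simp
  have hpw : p = x k - α k • ((∑ i, v i) + s) := by rw [hps, hzN]; module
  have hw : ‖(∑ i, v i) + s‖ ≤ L + N * C := by
    refine le_of_mul_le_mul_left ?_ hα0
    calc α k * ‖(∑ i, v i) + s‖ = ‖p - x k‖ := by
          rw [hpw, norm_sub_rev, sub_sub_cancel, norm_smul, Real.norm_of_nonneg hα0.le]
      _ ≤ _ := by linarith
  have hNC0 : 0 ≤ N * C := by positivity
  refine ⟨(∑ i, v i) + s, hpw, by linarith, fun i => v (σ.symm i), fun i => z (σ.symm i), s,
    fun i => ⟨by simpa using hv (σ.symm i), (hzbd _ (σ.symm i).2.le).trans ?_⟩, hsub, ?_, ?_⟩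
  · nlinarith
  · have := norm_sub_le ((∑ i, v i) + s) (∑ i, v i)
    rw [add_sub_cancel_left] at this
    linarith
  · rw [Equiv.sum_comp σ.symm v]

theorem IsPRR.ne_top {D : Fin N → Euc d → Set (Euc d)} {g : Euc d → EReal} {α : ℕ → ℝ}
    {x : ℕ → Euc d} (h : IsPRR N D g α x) (hg : ProperFn g)
    (hc : ConvexOn ℝ {x | g x ≠ ⊤} fun x => (g x).toReal) (hα : ∀ k, 0 < α k)
    (h0 : g (x 0) ≠ ⊤) (k : ℕ) : g (x k) ≠ ⊤ := by
  cases k with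
  | zero => exact h0
  | succ k =>
    obtain ⟨σ, z, -, -, hprox⟩ := h k
    exact (hg.mem_subdiff_iff.1 (smul_sub_mem_subdiff_of_prox hg hc (hα k) hprox)).1

end Step

section LimitCurve

/-- Reparametrization of the indices `0, …, m` by elapsed time, rescaled to `[0, 1]`. -/
theorem exists_time_index {a : ℕ → ℝ} {e : ℝ} (ha : ∀ k, 0 < a k) (hae : ∀ k, a k ≤ e) (m : ℕ) :
    ∃ κ : ℝ → ℕ, Monotone κ ∧ κ 0 = 0 ∧ κ 1 = m ∧ (∀ r, κ r ≤ m) ∧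
      ∀ r, max 0 (min r 1) * ∑ k ∈ Finset.range m, a k ≤ ∑ k ∈ Finset.range (κ r), a k ∧
        ∑ k ∈ Finset.range (κ r), a k ≤ max 0 (min r 1) * (∑ k ∈ Finset.range m, a k) + e := by
  set S : ℕ → ℝ := fun j => ∑ k ∈ Finset.range j, a k with hS
  have hSm : StrictMono S := strictMono_nat_of_lt_succ fun k => by
    simp only [hS, Finset.sum_range_succ]; linarith [ha k]
  have hS0 : S 0 = 0 := by simp [hS]
  have hSnn : ∀ j, 0 ≤ S j := fun j => hS0 ▸ hSm.monotone (Nat.zero_le j)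
  have hex : ∀ r : ℝ, ∃ k, max 0 (min r 1) * S m ≤ S k := fun r => by
    refine ⟨m, mul_le_of_le_one_left (hSnn m) (max_le zero_le_one (min_le_right _ _))⟩
  classical
  refine ⟨fun r => Nat.find (hex r), ?_, ?_, ?_, ?_, ?_⟩
  · intro r r' h
    refine Nat.find_mono fun k hk => le_trans ?_ hk
    have := hSnn m
    gcongr
  · simp [Nat.find_eq_zero, hS0]
  · rw [Nat.find_eq_iff]
    refine ⟨by simp, fun k hk => ?_⟩
    simpa using hSm hk
  · exact fun r => Nat.find_min' _
      (mul_le_of_le_one_left (hSnn m) (max_le zero_le_one (min_le_right _ _)))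
  · intro r
    refine ⟨Nat.find_spec (hex r), ?_⟩
    change S (Nat.find (hex r)) ≤ max 0 (min r 1) * S m + e
    have he : 0 ≤ e := (ha 0).le.trans (hae 0)
    have h0 : 0 ≤ max 0 (min r 1) * S m := mul_nonneg (le_max_left _ _) (hSnn m)
    rcases h : Nat.find (hex r) with _ | j
    · rw [hS0]; positivity
    · have := Nat.find_min (hex r) (m := j) (by omega)
      simp only [hS, Finset.sum_range_succ] at this ⊢
      linarith [hae j]

theorem abs_clamp_sub_le (r r' : ℝ) :
    |max 0 (min r 1) - max 0 (min r' 1)| ≤ |r - r'| := by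
  refine (abs_max_sub_max_le_max _ _ _ _).trans ?_
  refine max_le (by simp) ((abs_min_sub_min_le_max _ _ _ _).trans (by simp))

variable {V : Type*} [NormedAddCommGroup V]

theorem sub_eq_sum_Ico_smul [NormedSpace ℝ V] {a : ℕ → ℝ} {x w : ℕ → V} {m : ℕ}
    (hx : ∀ k < m, x (k + 1) = x k - a k • w k) {i j : ℕ} (hij : i ≤ j) (hj : j ≤ m) :
    x i - x j = ∑ k ∈ Finset.Ico i j, a k • w k := by
  induction j, hij using Nat.le_induction with
  | base => simp
  | succ j hij ih =>
    rw [Finset.sum_Ico_succ_top hij, ← ih (by omega), hx j (by omega)]; abel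

theorem Ultrafilter.exists_tendsto_of_norm_le [ProperSpace V] (U : Ultrafilter ℕ) {f : ℕ → V}
    {B : ℝ} (hf : ∀ n, ‖f n‖ ≤ B) : ∃ l, Filter.Tendsto f U (nhds l) := by
  obtain ⟨l, -, hl⟩ := (isCompact_closedBall (0 : V) B).ultrafilter_le_nhds' (U.map f)
    (Filter.Eventually.of_forall fun n => mem_closedBall_zero_iff.2 (hf n) :
      ∀ᶠ n in (U : Filter ℕ), f n ∈ Metric.closedBall (0 : V) B)
  exact ⟨l, hl⟩

/-- Along an ultrafilter, discrete trajectories with bounded velocities, bounded duration and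
vanishing step sizes converge to a Lipschitz curve, whose velocity at `r` belongs to every
closed convex set containing the discrete velocities of all iterates near that point. -/
theorem exists_limit_curve [NormedSpace ℝ V] [ProperSpace V] (U : Ultrafilter ℕ)
    {A B T : ℝ} (hA : 0 ≤ A)
    {a : ℕ → ℕ → ℝ} {x w : ℕ → ℕ → V} {m : ℕ → ℕ} {e : ℕ → ℝ}
    (he : Filter.Tendsto e U (nhds 0)) (ha : ∀ n k, 0 < a n k) (hae : ∀ n k, a n k ≤ e n)
    (hx : ∀ n, ∀ k < m n, x n (k + 1) = x n k - a n k • w n k)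
    (hw : ∀ n, ∀ k < m n, ‖w n k‖ ≤ A)
    (hT : ∀ n, ∑ k ∈ Finset.range (m n), a n k ≤ T) (hB : ∀ n, ‖x n 0‖ ≤ B) :
    ∃ (y : ℝ → V) (τ : ℝ),
      0 ≤ τ ∧ Filter.Tendsto (fun n => ∑ k ∈ Finset.range (m n), a n k) U (nhds τ) ∧
      LipschitzWith (A * τ).toNNReal y ∧
      Filter.Tendsto (fun n => x n 0) U (nhds (y 0)) ∧
      Filter.Tendsto (fun n => x n (m n)) U (nhds (y 1)) ∧
      (∀ r, ∃ k : ℕ → ℕ, Filter.Tendsto (fun n => x n (k n)) U (nhds (y r))) ∧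
      ∀ r ∈ Set.Ioo (0 : ℝ) 1, ∀ y', HasDerivAt y y' r → ∀ Q : Set V, IsClosed Q → Convex ℝ Q →
        ∀ ρ > 0, (∀ᶠ n in U, ∀ j < m n, ‖x n j - y r‖ < ρ → w n j ∈ Q) → 0 < τ →
          -(τ⁻¹ • y') ∈ Q := by
  choose κ hκmono hκ0 hκ1 hκm hκ using fun n => exists_time_index (ha n) (hae n) (m n)
  set S : ℕ → ℕ → ℝ := fun n j => ∑ k ∈ Finset.range j, a n k with hS
  have hSm : ∀ n, Monotone (S n) := fun n => monotone_nat_of_le_succ fun k => by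
    simp only [hS, Finset.sum_range_succ]; linarith [ha n k]
  have hSnn : ∀ n j, 0 ≤ S n j := fun n j => Finset.sum_nonneg fun k _ => (ha n k).le
  have hIco : ∀ n i j, i ≤ j → ∑ k ∈ Finset.Ico i j, a n k = S n j - S n i := fun n i j hij =>
    Finset.sum_Ico_eq_sub _ hij
  have hdist : ∀ n i j, i ≤ j → j ≤ m n → ‖x n i - x n j‖ ≤ A * (S n j - S n i) := by
    intro n i j hij hj
    rw [sub_eq_sum_Ico_smul (hx n) hij hj, ← hIco n i j hij, Finset.mul_sum]
    refine norm_sum_le_of_le _ fun k hk => ?_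
    rw [norm_smul, Real.norm_of_nonneg (ha n k).le, mul_comm]
    gcongr
    · exact (ha n k).le
    · exact hw n k (by rw [Finset.mem_Ico] at hk; omega)
  have hbd : ∀ r n, ‖x n (κ n r)‖ ≤ B + A * T := by
    intro r n
    have h1 := hdist n 0 (κ n r) (Nat.zero_le _) (hκm n r)
    have h2 : A * (S n (κ n r) - S n 0) ≤ A * T := by
      gcongr
      linarith [hSm n (hκm n r), hT n, hSnn n 0]
    linarith [hB n, norm_le_norm_add_norm_sub (x n 0) (x n (κ n r))]
  choose y hy using fun r => U.exists_tendsto_of_norm_le (hbd r)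
  obtain ⟨τ, hτ⟩ := U.exists_tendsto_of_norm_le (f := fun n => S n (m n)) (B := T) fun n => by
    rw [Real.norm_of_nonneg (hSnn n _)]; exact hT n
  have hτ0 : 0 ≤ τ := ge_of_tendsto' hτ fun n => hSnn n _
  have hSκ : ∀ r, Filter.Tendsto (fun n => S n (κ n r)) U (nhds (max 0 (min r 1) * τ)) := by
    intro r
    refine tendsto_of_tendsto_of_tendsto_of_le_of_le (hτ.const_mul _)
      (by simpa using (hτ.const_mul (max 0 (min r 1))).add he)
      (fun n => (hκ n r).1) fun n => (hκ n r).2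
  have hlip : ∀ r r', r ≤ r' → ‖y r - y r'‖ ≤ A * τ * |r - r'| := by
    intro r r' hr
    have h1 : ‖y r - y r'‖ ≤ A * (max 0 (min r' 1) * τ - max 0 (min r 1) * τ) :=
      le_of_tendsto_of_tendsto' ((hy r).sub (hy r')).norm
        (((hSκ r').sub (hSκ r)).const_mul A)
        fun n => hdist n _ _ (hκmono n hr) (hκm n r')
    have h2 : max 0 (min r' 1) - max 0 (min r 1) ≤ |r - r'| := by
      rw [abs_sub_comm]
      exact (le_abs_self _).trans (abs_clamp_sub_le r' r)
    calc _ ≤ _ := h1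
      _ = A * τ * (max 0 (min r' 1) - max 0 (min r 1)) := by ring
      _ ≤ _ := by gcongr
  refine ⟨y, τ, hτ0, hτ, ?_, by simpa [hκ0] using hy 0, by simpa [hκ1] using hy 1,
    fun r => ⟨fun n => κ n r, hy r⟩, ?_⟩
  · refine LipschitzWith.of_dist_le_mul fun r r' => ?_
    rw [Real.coe_toNNReal _ (by positivity), dist_eq_norm, Real.dist_eq]
    rcases le_total r r' with h | h
    · exact hlip r r' h
    · rw [norm_sub_rev, abs_sub_comm]; exact hlip r' r h
  intro r hr y' hy' Q hQ hQc ρ hρ hwQ hτpos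
  have hslope : Filter.Tendsto (fun r' => -(τ⁻¹ • slope y r r')) (nhdsWithin r (Set.Ioi r))
      (nhds (-(τ⁻¹ • y'))) :=
    ((hasDerivAt_iff_tendsto_slope.1 hy').mono_left
      (nhdsWithin_mono _ fun s hs => (ne_of_gt hs : s ≠ r))).const_smul _ |>.neg
  refine hQ.mem_of_tendsto hslope ?_
  have hnear : ∀ᶠ r' in nhdsWithin r (Set.Ioi r), A * (r' * τ - r * τ) < ρ / 2 := by
    refine Filter.Eventually.filter_mono nhdsWithin_le_nhds ?_
    have : Continuous fun r' : ℝ => A * (r' * τ - r * τ) := by fun_prop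
    exact this.continuousAt.eventually_lt_const (by simpa using hρ)
  filter_upwards [Ioo_mem_nhdsGT hr.2, hnear] with r' hr' hr'ρ
  have hc : max 0 (min r 1) = r := by rw [min_eq_left hr.2.le, max_eq_right hr.1.le]
  have hc' : max 0 (min r' 1) = r' := by
    rw [min_eq_left hr'.2.le, max_eq_right (hr.1.trans hr'.1).le]
  have hΔ := (hSκ r').sub (hSκ r)
  rw [hc, hc'] at hΔ
  have hΔpos : 0 < r' * τ - r * τ := by rw [← sub_mul]; exact mul_pos (sub_pos.2 hr'.1) hτpos
  have hlim := (hΔ.inv₀ hΔpos.ne').smul ((hy r).sub (hy r'))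
  have heq : (r' * τ - r * τ)⁻¹ • (y r - y r') = -(τ⁻¹ • slope y r r') := by
    rw [slope_def_module, ← sub_mul, mul_inv, mul_comm, mul_smul, ← smul_neg, ← smul_neg, neg_sub]
  rw [heq] at hlim
  refine hQ.mem_of_tendsto hlim ?_
  have hyr : ∀ᶠ n in U, ‖x n (κ n r) - y r‖ < ρ / 2 := by
    have := tendsto_iff_norm_sub_tendsto_zero.1 (hy r)
    exact this.eventually_lt_const (by positivity)
  filter_upwards [hwQ, hyr, (hΔ.const_mul A).eventually_lt_const hr'ρ,
    hΔ.eventually_const_lt hΔpos] with n h1 h2 h3 h4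
  have hle := hκmono n hr'.1.le
  rw [sub_eq_sum_Ico_smul (hx n) hle (hκm n r'), ← hIco n _ _ hle]
  refine hQc.centerMass_mem (fun k _ => (ha n k).le) (by rwa [hIco n _ _ hle]) fun k hk => ?_
  rw [Finset.mem_Ico] at hk
  have hkm : k < m n := hk.2.trans_le (hκm n r')
  refine h1 k hkm ?_
  have h5 := hdist n _ k hk.1 hkm.le
  have h6 : A * (S n k - S n (κ n r)) ≤ A * (S n (κ n r') - S n (κ n r)) := by
    gcongr
    exact hSm n hk.2.le
  have h7 := norm_sub_le_norm_sub_add_norm_sub (x n k) (x n (κ n r)) (y r)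
  rw [norm_sub_rev] at h5
  linarith

end LimitCurve

section Descent

variable {d N : ℕ} {f : Fin N → Euc d → ℝ} {D : Fin N → Euc d → Set (Euc d)} {g : Euc d → EReal}

theorem absolutelyContinuousOnInterval_comp (hf : ∀ i, LocallyLipschitz (f i))
    (hc : ConvexOn ℝ {x | g x ≠ ⊤} fun x => (g x).toReal) (hl : LocLipOnDom g) {C : NNReal}
    {y : ℝ → Euc d} (hy : LipschitzWith C y) (hyg : ∀ r, g (y r) ≠ ⊤) :
    AbsolutelyContinuousOnInterval (fun r => (g (y r)).toReal) 0 1 ∧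
    AbsolutelyContinuousOnInterval (fun r => (∑ i, f i (y r)) + (g (y r)).toReal) 0 1 := by
  have h1 : ∀ i, ∃ K, LipschitzOnWith K (fun r => f i (y r)) (Set.uIcc 0 1) := fun i =>
    LocallyLipschitzOn.exists_lipschitzOnWith_of_compact isCompact_uIcc
      ((hf i).comp hy.locallyLipschitz).locallyLipschitzOn
  choose K hK using h1
  have h2 : LipschitzOnWith (∑ i, K i) (fun r => ∑ i, f i (y r)) (Set.uIcc 0 1) := by
    refine LipschitzOnWith.of_dist_le_mul fun r hr s hs => ?_
    refine (dist_sum_sum_le _ _ _).trans ?_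
    rw [NNReal.coe_sum, Finset.sum_mul]
    exact Finset.sum_le_sum fun i _ => (hK i).dist_le_mul r hr s hs
  obtain ⟨L, hL0, hL⟩ := hl.exists_forall_sub_le hc
    ((isCompact_uIcc (a := (0 : ℝ)) (b := 1)).image hy.continuous)
    (by rintro _ ⟨r, -, rfl⟩; exact hyg r)
  have h3 : LipschitzOnWith (L.toNNReal * C) (fun r => (g (y r)).toReal) (Set.uIcc 0 1) := by
    refine LipschitzOnWith.of_dist_le_mul fun r hr s hs => ?_
    have h4 := hy.dist_le_mul r s
    have h5 := hL _ ⟨r, hr, rfl⟩ _ (hyg s)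
    have h6 := hL _ ⟨s, hs, rfl⟩ _ (hyg r)
    rw [NNReal.coe_mul, Real.coe_toNNReal _ hL0, mul_assoc]
    refine le_trans ?_ (mul_le_mul_of_nonneg_left h4 hL0)
    rw [norm_sub_rev] at h5
    rw [Real.dist_eq, dist_eq_norm, abs_le]
    constructor <;> linarith
  exact ⟨h3.absolutelyContinuousOnInterval,
    h2.absolutelyContinuousOnInterval.add h3.absolutelyContinuousOnInterval⟩

/-- Chain rule for the objective along a trajectory of the (time-scaled) differential inclusion
`dy/dt ∈ -τ D_Φ(y)`. -/
theorem ae_hasDerivAt_objective (hf : ∀ i, LocallyLipschitz (f i))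
    (hD : ∀ i, IsConservativeFieldR (D i) (f i)) (hDne : ∀ i x, (D i x).Nonempty)
    (hg : ProperFn g) (hc : ConvexOn ℝ {x | g x ≠ ⊤} fun x => (g x).toReal)
    (hl : LocLipOnDom g) {C : NNReal} {y : ℝ → Euc d} (hy : LipschitzWith C y)
    (hyg : ∀ r, g (y r) ≠ ⊤) {τ : ℝ}
    (hyD : ∀ r ∈ Set.Ioo (0 : ℝ) 1, ∀ u, HasDerivAt y u r → ∃ w ∈ DPhi N D g (y r), u = -(τ • w)) :
    ∀ᵐ r, r ∈ Set.Ioo (0 : ℝ) 1 → ∃ w ∈ DPhi N D g (y r), HasDerivAt y (-(τ • w)) r ∧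
      HasDerivAt (fun r => (∑ i, f i (y r)) + (g (y r)).toReal) (-(τ * ‖w‖ ^ 2)) r := by
  have hchain : ∀ᵐ r, ∀ i, r ∈ Set.Ioo (0 : ℝ) 1 → ∀ v ∈ D i (y r),
      HasDerivAt (fun s => f i (y s)) ⟪v, deriv y r⟫ r := by
    refine ae_all_iff.2 fun i => (hD i).2 y (deriv y) (hy.integral_deriv_eq_sub 0 1).1
      (fun t _ => ?_) fun t _ => hDne i _
    rw [(hy.integral_deriv_eq_sub 0 t).2, add_sub_cancel]
  filter_upwards [hchain, hy.ae_differentiableAt_real,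
    (absolutelyContinuousOnInterval_comp hf hc hl hy hyg).1.ae_differentiableAt]
    with r hfr hyr hgr hr
  have hgr := (hgr (by rw [Set.uIcc_of_le zero_le_one]; exact Set.Ioo_subset_Icc_self hr)).hasDerivAt
  obtain ⟨w, hw, hu⟩ := hyD r hr _ hyr.hasDerivAt
  have hyw := hyr.hasDerivAt
  refine ⟨w, hw, hu ▸ hyw, ?_⟩
  obtain ⟨v, hv, s, hs, rfl⟩ := hw
  have hg' : deriv (fun r => (g (y r)).toReal) r = ⟪s, deriv y r⟫ := by
    have h1 : HasDerivAt (fun t => (g (y t)).toReal - ⟪s, y t⟫)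
        (deriv (fun r => (g (y r)).toReal) r - ⟪s, deriv y r⟫) r :=
      (hgr.fun_sub ((hasDerivAt_const r s).inner ℝ hyw)).congr_deriv (by simp)
    have h2 : IsLocalMin (fun t => (g (y t)).toReal - ⟪s, y t⟫) r := by
      refine Filter.Eventually.of_forall fun t => ?_
      have := (hg.mem_subdiff_iff.1 hs).2 (y t) (hyg t)
      rw [inner_sub_right] at this
      simp only
      linarith
    linarith [h2.hasDerivAt_eq_zero h1]
  rw [hg'] at hgr
  refine ((HasDerivAt.fun_sum fun i (_ : i ∈ Finset.univ) =>
    hfr i hr (v i) (hv i)).fun_add hgr).congr_deriv ?_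
  rw [← sum_inner, ← inner_add_left, hu, inner_neg_right, real_inner_smul_right,
    real_inner_self_eq_norm_sq]

/-- Along a trajectory of `dy/dt ∈ -τ D_Φ(y)` on which `D_Φ` is bounded away from zero, the objective
decreases proportionally both to the elapsed time and to the distance travelled. -/
theorem objective_decrease (hf : ∀ i, LocallyLipschitz (f i))
    (hD : ∀ i, IsConservativeFieldR (D i) (f i)) (hDne : ∀ i x, (D i x).Nonempty)
    (hg : ProperFn g) (hc : ConvexOn ℝ {x | g x ≠ ⊤} fun x => (g x).toReal)
    (hl : LocLipOnDom g) {C : NNReal} {y : ℝ → Euc d} (hy : LipschitzWith C y)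
    (hyg : ∀ r, g (y r) ≠ ⊤) {τ δ : ℝ} (hτ : 0 ≤ τ) (hδ : 0 ≤ δ)
    (hyD : ∀ r ∈ Set.Ioo (0 : ℝ) 1, ∀ u, HasDerivAt y u r → ∃ w ∈ DPhi N D g (y r), u = -(τ • w))
    (hδD : ∀ r, ∀ w ∈ DPhi N D g (y r), δ ≤ ‖w‖) :
    (∑ i, f i (y 1)) + (g (y 1)).toReal + τ * δ ^ 2 ≤
      (∑ i, f i (y 0)) + (g (y 0)).toReal ∧
    (∑ i, f i (y 1)) + (g (y 1)).toReal + δ * ‖y 1 - y 0‖ ≤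
      (∑ i, f i (y 0)) + (g (y 0)).toReal := by
  have hac := (absolutelyContinuousOnInterval_comp hf hc hl hy hyg).2
  have hder := ae_hasDerivAt_objective hf hD hDne hg hc hl hy hyg hyD
  constructor
  · have hlin : LipschitzWith (τ * δ ^ 2).toNNReal fun r : ℝ => τ * δ ^ 2 * r := by
      refine LipschitzWith.of_dist_le_mul fun r s => ?_
      rw [Real.coe_toNNReal _ (by positivity), Real.dist_eq, Real.dist_eq, ← mul_sub, abs_mul,
        abs_of_nonneg (by positivity : 0 ≤ τ * δ ^ 2)]
    have := (hac.add (hlin.lipschitzOnWith (s := Set.uIcc 0 1)).absolutelyContinuousOnInterval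
      ).apply_one_le_apply_zero ?_
    · simpa using this
    filter_upwards [hder] with r hr hr01
    obtain ⟨w, hw, -, h⟩ := hr hr01
    refine ⟨_, ?_, h.add ((hasDerivAt_id r).const_mul (τ * δ ^ 2))⟩
    have := hδD r w hw
    have : τ * δ ^ 2 ≤ τ * ‖w‖ ^ 2 := by gcongr
    linarith
  · obtain ⟨v, hv, hvy⟩ : ∃ v : Euc d, ‖v‖ ≤ 1 ∧ ⟪v, y 1 - y 0⟫ = ‖y 1 - y 0‖ := by
      rcases eq_or_ne (y 1 - y 0) 0 with h | h
      · exact ⟨0, by simp, by simp [h]⟩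
      · refine ⟨‖y 1 - y 0‖⁻¹ • (y 1 - y 0), ?_, ?_⟩
        · rw [norm_smul, norm_inv, norm_norm, inv_mul_cancel₀ (norm_ne_zero_iff.2 h)]
        · rw [real_inner_smul_left, real_inner_self_eq_norm_sq, sq,
            inv_mul_cancel_left₀ (norm_ne_zero_iff.2 h)]
    have hlin : LipschitzWith (δ.toNNReal * C) fun r : ℝ => δ * ⟪v, y r⟫ := by
      refine LipschitzWith.of_dist_le_mul fun r s => ?_
      rw [NNReal.coe_mul, Real.coe_toNNReal _ hδ, Real.dist_eq, ← mul_sub, ← inner_sub_right,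
        abs_mul, abs_of_nonneg hδ, mul_assoc]
      refine mul_le_mul_of_nonneg_left ?_ hδ
      calc _ ≤ ‖v‖ * ‖y r - y s‖ := abs_real_inner_le_norm _ _
        _ ≤ 1 * ‖y r - y s‖ := by gcongr
        _ ≤ _ := by rw [one_mul, ← dist_eq_norm]; exact hy.dist_le_mul r s
    have := (hac.add (hlin.lipschitzOnWith (s := Set.uIcc 0 1)).absolutelyContinuousOnInterval
      ).apply_one_le_apply_zero ?_
    · rw [← hvy, inner_sub_right]
      simp only [Pi.add_apply] at this
      linarith
    filter_upwards [hder] with r hr hr01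
    obtain ⟨w, hw, hyw, h⟩ := hr hr01
    refine ⟨_, ?_, h.add (((hasDerivAt_const r v).inner ℝ hyw).const_mul δ)⟩
    have h1 := hδD r w hw
    have h2 := (abs_le.1 (abs_real_inner_le_norm v w)).1
    have h3 : ‖v‖ * ‖w‖ ≤ ‖w‖ := mul_le_of_le_one_left (norm_nonneg _) hv
    simp only [inner_neg_right, real_inner_smul_right, inner_zero_left, add_zero]
    have h4 : δ * -⟪v, w⟫ ≤ ‖w‖ * ‖w‖ := by
      calc _ ≤ δ * ‖w‖ := by gcongr; linarith
        _ ≤ _ := by gcongr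
    nlinarith

end Descent

/-- A vector lying in every closed convex set that contains the discrete velocities near a point
belongs to `boundedDPhi` at that point. -/
theorem mem_boundedDPhi_of_isBoundedStep {d N : ℕ} {D : Fin N → Euc d → Set (Euc d)}
    {g : Euc d → EReal} (hD : ∀ i, IsClosed {p : Euc d × Euc d | p.2 ∈ D i p.1})
    (hDb : ∀ i, LocBounded (D i)) (hDc : ∀ i x, Convex ℝ (D i x)) (hg : ProperFn g)
    (hgc : IsClosed {p : Euc d × Euc d | p.2 ∈ Subdiff g p.1}) {U : Ultrafilter ℕ} {A : ℝ}
    {a : ℕ → ℕ → ℝ} {x w : ℕ → ℕ → Euc d} {m : ℕ → ℕ} {e : ℕ → ℝ}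
    (he : Filter.Tendsto e U (nhds 0)) (ha : ∀ n k, 0 < a n k) (hae : ∀ n k, a n k ≤ e n)
    (hA : 0 ≤ A)
    (hstep : ∀ n, ∀ k < m n, IsBoundedStep D g A (a n k) (x n k) (x n (k + 1)) (w n k))
    {x' u : Euc d}
    (hu : ∀ Q : Set (Euc d), IsClosed Q → Convex ℝ Q → ∀ ρ > 0,
      (∀ᶠ n in U, ∀ j < m n, ‖x n j - x'‖ < ρ → w n j ∈ Q) → u ∈ Q) :
    u ∈ boundedDPhi D g A x' := by
  rw [← (isCompact_boundedDPhi hD hDb hgc A x').isClosed.closure_eq,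
    Metric.closure_eq_iInter_cthickening]
  refine Set.mem_iInter₂.2 fun η hη => ?_
  obtain ⟨ρ, hρ, h⟩ := exists_forall_mem_cthickening_boundedDPhi hD hDb hgc A x' hη
  refine hu _ Metric.isClosed_cthickening
    ((convex_boundedDPhi hg (fun i => hDc i x') A).cthickening η) (ρ / 2) (by positivity) ?_
  have hlim : Filter.Tendsto (fun n => A * e n) U (nhds 0) := by simpa using he.const_mul A
  filter_upwards [hlim.eventually_lt_const (half_pos hρ)] with n hn j hj hxj
  obtain ⟨hp, hwA, v, ζ, s, hv, hs, hsA, hw⟩ := hstep n j hj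
  have haj : A * a n j < ρ / 2 :=
    (mul_le_mul_of_nonneg_left (hae n j) hA).trans_lt hn
  rw [hw]
  refine h ζ v _ s (fun i => ?_) ?_ (fun i => (hv i).1) hs hsA
  · linarith [(hv i).2, norm_sub_le_norm_sub_add_norm_sub (ζ i) (x n j) x']
  · have h1 : ‖x n (j + 1) - x n j‖ ≤ A * a n j := by
      rw [hp, norm_sub_rev, sub_sub_cancel, norm_smul, Real.norm_of_nonneg (ha n j).le, mul_comm]
      exact mul_le_mul_of_nonneg_right hwA (ha n j).le
    linarith [norm_sub_le_norm_sub_add_norm_sub (x n (j + 1)) (x n j) x']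

/-- under the standing assumptions, with small enough nonsummable
step sizes, proximal random reshuffling initialized in a bounded subset of
`dom Φ` produces at least one `(ε,δ)`-near approximate `D_Φ`-stationary iterate,
i.e. `inf {‖v‖ : v ∈ D_Φ(y), ‖y − x_k‖ ≤ ε} ≤ δ`. -/
theorem stmt10 {d N : ℕ} (hN : 1 ≤ N) (f : Fin N → Euc d → ℝ)
    (D : Fin N → Euc d → Set (Euc d)) (g : Euc d → EReal)
    (hSA : StandingAssumptions N f D g)
    (δ ε : ℝ) (hδ : 0 < δ) (hε : 0 < ε)
    (X₀ : Set (Euc d)) (hX₀b : Bornology.IsBounded X₀)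
    (hX₀dom : ∀ x ∈ X₀, Phi N f g x ≠ ⊤) :
    ∃ αbar > (0:ℝ), ∀ (α : ℕ → ℝ) (xs : ℕ → Euc d),
      IsPRR N D g α xs → xs 0 ∈ X₀ → (∀ k, 0 < α k ∧ α k ≤ αbar) →
      Filter.Tendsto (fun n => ∑ i ∈ Finset.range n, α i) Filter.atTop Filter.atTop →
      ∃ k : ℕ, EMetric.infEdist (0 : Euc d)
          {v : Euc d | ∃ y : Euc d, ‖y - xs k‖ ≤ ε ∧ v ∈ DPhi N D g y} ≤
        ENNReal.ofReal δ := by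
  obtain ⟨hf, hD, hDb, hDnc, hg, hgcv, hcl, hl, c, hcΦ⟩ := hSA
  have hc := hgcv.convexOn_toReal hg
  have hgc := hg.isClosed_graph_subdiff hcl hl
  obtain ⟨R₀, hR₀⟩ := hX₀b.subset_closedBall 0
  set F : Euc d → ℝ := fun x => (∑ i, f i x) + (g x).toReal with hF
  have hcF : ∀ x, g x ≠ ⊤ → c ≤ F x := fun x hx => by
    have := hcΦ x
    rw [Phi, ← hg.coe_toReal hx] at this
    exact_mod_cast this
  obtain ⟨M, hM⟩ : ∃ M, ∀ x, g x ≠ ⊤ → ‖x‖ ≤ R₀ → F x ≤ M := by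
    have hFc : ContinuousOn F {x | g x ≠ ⊤} :=
      (continuous_finsetSum _ fun i _ => (hf i).continuous).continuousOn.add hl.continuousOn
    obtain ⟨M, hM⟩ := ((isCompact_closedBall (0 : Euc d) R₀).inter_left hcl).bddAbove_image
      (hFc.mono Set.inter_subset_left)
    exact ⟨M, fun x hx hxR => hM ⟨x, ⟨hx, mem_closedBall_zero_iff.2 hxR⟩, rfl⟩⟩
  set R := R₀ + |M - c| / δ + 1 with hR
  set T := |M - c| / δ ^ 2 + 1 with hT
  obtain ⟨A, hA, α₀, hα₀, hstep⟩ := exists_isBoundedStep hDb hg hc hcl hl R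
  by_contra! hcon
  have hpos : ∀ n : ℕ, 0 < α₀ / ((n : ℝ) + 1) := fun n => by positivity
  choose α xs hprr hx0 hα hsum hfar using fun n : ℕ => hcon _ (hpos n)
  have hle : ∀ n : ℕ, α₀ / ((n : ℝ) + 1) ≤ α₀ := fun n =>
    div_le_self hα₀.le (by linarith [n.cast_nonneg (α := ℝ)])
  have hxR₀ : ∀ n, ‖xs n 0‖ ≤ R₀ := fun n => mem_closedBall_zero_iff.1 (hR₀ (hx0 n))
  have hxg : ∀ n k, g (xs n k) ≠ ⊤ := fun n => (hprr n).ne_top hg hc (fun k => (hα n k).1)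
    fun h => hX₀dom _ (hx0 n) (by simp [Phi, h])
  have hreach : ∀ n, ∃ j, R ≤ ‖xs n j‖ ∨ T ≤ ∑ i ∈ Finset.range j, α n i := fun n =>
    ((hsum n).eventually_ge_atTop T).exists.imp fun _ => Or.inr
  classical
  set m : ℕ → ℕ := fun n => Nat.find (hreach n) with hm
  have hlt : ∀ n, ∀ k < m n, ‖xs n k‖ < R ∧ ∑ i ∈ Finset.range k, α n i < T := fun n k hk => by
    simpa only [not_or, not_le] using Nat.find_min (hreach n) hk
  have hw : ∀ n k, ∃ w, k < m n → IsBoundedStep D g A (α n k) (xs n k) (xs n (k + 1)) w := by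
    intro n k
    by_cases hk : k < m n
    · obtain ⟨w, hw⟩ := hstep (α n) (xs n) (hprr n) k (hα n k).1 ((hα n k).2.trans (hle n))
        (hlt n k hk).1.le (hxg n k)
      exact ⟨w, fun _ => hw⟩
    · exact ⟨0, fun h => absurd h hk⟩
  choose w hw using hw
  have hTm : ∀ n, ∑ i ∈ Finset.range (m n), α n i ≤ T + α₀ := by
    intro n
    rcases h : m n with _ | j
    · simp only [Finset.range_zero, Finset.sum_empty]; positivity
    · rw [Finset.sum_range_succ]
      have := (hlt n j (by omega)).2
      linarith [(hα n j).2, hle n]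
  set U := Filter.hyperfilter ℕ
  have he : Filter.Tendsto (fun n : ℕ => α₀ / ((n : ℝ) + 1)) U (nhds 0) :=
    ((tendsto_const_nhds (x := α₀)).div_atTop
      (Filter.tendsto_atTop_add_const_right _ 1 tendsto_natCast_atTop_atTop)).mono_left
      Nat.hyperfilter_le_atTop
  obtain ⟨y, τ, hτ0, hτ, hy, hy0, hy1, hyk, hyQ⟩ := exists_limit_curve U hA he
    (fun n k => (hα n k).1) (fun n k => (hα n k).2) (fun n k hk => (hw n k hk).1)
    (fun n k hk => (hw n k hk).2.1) hTm hxR₀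
  have hyg : ∀ r, g (y r) ≠ ⊤ := fun r => by
    obtain ⟨k, hk⟩ := hyk r
    exact hcl.mem_of_tendsto hk (Filter.Eventually.of_forall fun n => hxg n (k n))
  have hyR₀ : ‖y 0‖ ≤ R₀ := le_of_tendsto' hy0.norm hxR₀
  have hlast : 0 ≤ max (‖y 1‖ - R) (τ - T) := by
    refine ge_of_tendsto' ((hy1.norm.sub_const R).max (hτ.sub_const T)) fun n => ?_
    rw [le_max_iff, sub_nonneg, sub_nonneg]
    exact Nat.find_spec (hreach n)
  have hquot : 0 ≤ |M - c| / δ := by positivity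
  have hquot' : 0 ≤ |M - c| / δ ^ 2 := by positivity
  have hδD : ∀ r, ∀ v ∈ DPhi N D g (y r), δ ≤ ‖v‖ := by
    intro r v hv
    obtain ⟨k, hk⟩ := hyk r
    obtain ⟨n, hn⟩ := ((tendsto_iff_norm_sub_tendsto_zero.1 hk).eventually_lt_const hε).exists
    rw [norm_sub_rev] at hn
    have h1 := (hfar n (k n)).trans_le (Metric.infEDist_le_edist_of_mem ⟨y r, hn.le, hv⟩)
    rw [edist_dist, dist_zero_left] at h1
    exact ((ENNReal.ofReal_lt_ofReal_iff_of_nonneg hδ.le).1 h1).le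
  have hclose : ‖y 1‖ < R ∧ τ < T := by
    rcases hτ0.eq_or_lt with rfl | hτpos
    · have h := hy.dist_le_mul 1 0
      simp only [mul_zero, Real.toNNReal_zero, NNReal.coe_zero, zero_mul] at h
      rw [dist_le_zero.1 h]
      constructor <;> linarith
    have hyD : ∀ r ∈ Set.Ioo (0 : ℝ) 1, ∀ u, HasDerivAt y u r →
        ∃ w ∈ DPhi N D g (y r), u = -(τ • w) := by
      intro r hr u hu
      refine ⟨-(τ⁻¹ • u), boundedDPhi_subset D g A _ ?_, ?_⟩
      · exact mem_boundedDPhi_of_isBoundedStep (fun i => (hD i).1) hDb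
          (fun i x => (hDnc i x).2) hg hgc he (fun n k => (hα n k).1) (fun n k => (hα n k).2) hA hw
          fun Q hQ hQc ρ hρ h => hyQ r hr u hu Q hQ hQc ρ hρ h hτpos
      · rw [smul_neg, neg_neg, smul_inv_smul₀ hτpos.ne']
    obtain ⟨h1, h2⟩ := objective_decrease hf hD (fun i x => (hDnc i x).1) hg hc hl hy hyg hτ0
      hδ.le hyD hδD
    have h3 := hM _ (hyg 0) hyR₀
    have h4 := hcF _ (hyg 1)
    have h5 := le_abs_self (M - c)
    simp only [hF] at h3 h4
    constructor
    · have : ‖y 1 - y 0‖ ≤ |M - c| / δ := by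
        rw [le_div_iff₀ hδ]; linarith
      linarith [norm_le_norm_add_norm_sub' (y 1) (y 0)]
    · have : τ ≤ |M - c| / δ ^ 2 := by
        rw [le_div_iff₀ (by positivity)]; linarith
      linarith
  exact absurd hlast (not_le.2 (max_lt (by linarith [hclose.1]) (by linarith [hclose.2])))
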